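/- arXiv:2501.01221 — 2 statements merged into one kernel-verified Lean document; each statement's English description precedes it below -/
import Mathlib

section
/- For a function O:[0,1]²→[0,1] the following three statements are equivalent: (1) there exist a∈[0,∞), a continuous and strictly decreasing function θ:[0,1]→[0,∞] and a continuous and decreasing function ϑ:[0,∞]→[0,1] such that O(x,y)=ϑ(θ(x)+θ(y)) for all x,y∈[0,1], O is an overlap function, and at least one of the following holds: (a) θ(x)=a/2 if and only if x=1, or (b) ϑ(x)=1 if and only if x∈[0,a]; (2) there exist a pseudo automorphism F:[0,1]→[0,1] and a strict t-norm T:[0,1]²→[0,1] such that O(x,y)=F(T(x,y)) for all x,y∈[0,1]; (3) there exist a strictly increasing bijection φ:[0,1]→[0,1] and a pseudo automorphism H:[0,1]→[0,1] such that O(x,y)=H(φ(x)·φ(y)) for all x,y∈[0,1]. -/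
open unitInterval ENNReal

/-- An overlap function on the unit interval: commutative, `O x y = 0` iff `x*y = 0`,
`O x y = 1` iff `x*y = 1`, increasing in each variable, and continuous. -/
def IsOverlap (O : I → I → I) : Prop :=
  (∀ x y, O x y = O y x) ∧
  (∀ x y, O x y = 0 ↔ x * y = 0) ∧
  (∀ x y, O x y = 1 ↔ x * y = 1) ∧
  (∀ y, Monotone fun x => O x y) ∧
  (∀ x, Monotone fun y => O x y) ∧
  Continuous fun p : I × I => O p.1 p.2

/-- A grouping function on the unit interval: commutative, `G x y = 0` iff `x = y = 0`,
`G x y = 1` iff `x = 1` or `y = 1`, increasing in each variable, and continuous. -/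
def IsGrouping (G : I → I → I) : Prop :=
  (∀ x y, G x y = G y x) ∧
  (∀ x y, G x y = 0 ↔ x = 0 ∧ y = 0) ∧
  (∀ x y, G x y = 1 ↔ x = 1 ∨ y = 1) ∧
  (∀ y, Monotone fun x => G x y) ∧
  (∀ x, Monotone fun y => G x y) ∧
  Continuous fun p : I × I => G p.1 p.2

/-- A t-norm: commutative, associative, increasing in each variable, with 1 as neutral element. -/
def IsTNorm (T : I → I → I) : Prop :=
  (∀ x y, T x y = T y x) ∧
  (∀ x y z, T (T x y) z = T x (T y z)) ∧
  (∀ y, Monotone fun x => T x y) ∧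
  (∀ x, Monotone fun y => T x y) ∧
  (∀ x, T x 1 = x)

/-- A t-conorm: commutative, associative, increasing in each variable, with 0 as neutral element. -/
def IsTConorm (S : I → I → I) : Prop :=
  (∀ x y, S x y = S y x) ∧
  (∀ x y z, S (S x y) z = S x (S y z)) ∧
  (∀ y, Monotone fun x => S x y) ∧
  (∀ x, Monotone fun y => S x y) ∧
  (∀ x, S x 0 = x)

/-- A t-subnorm: commutative, associative, increasing in each variable, bounded by `min`. -/
def IsTSubnorm (T : I → I → I) : Prop :=
  (∀ x y, T x y = T y x) ∧
  (∀ x y z, T (T x y) z = T x (T y z)) ∧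
  (∀ y, Monotone fun x => T x y) ∧
  (∀ x, Monotone fun y => T x y) ∧
  (∀ x y, T x y ≤ min x y)

/-- A pseudo automorphism of the unit interval. -/
def IsPseudoAutomorphism (F : I → I) : Prop :=
  Monotone F ∧ Continuous F ∧ (∀ x, F x = 1 ↔ x = 1) ∧ (∀ x, F x = 0 ↔ x = 0)

/-- A strict t-norm: a continuous t-norm strictly increasing in each variable on `(0,1]²`. -/
def IsStrictTNorm (T : I → I → I) : Prop :=
  IsTNorm T ∧ (Continuous fun p : I × I => T p.1 p.2) ∧
  (∀ y : I, 0 < y → StrictMonoOn (fun x => T x y) {x : I | 0 < x}) ∧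
  (∀ x : I, 0 < x → StrictMonoOn (fun y => T x y) {y : I | 0 < y})

/-- Condition (1): `O` is an overlap function additively generated by a pair `(θ, ϑ)`
with `θ` strictly decreasing, satisfying (a) or (b). -/
def Cond1 (O : I → I → I) : Prop :=
  ∃ a : ℝ≥0∞, a ≠ ⊤ ∧ ∃ (θ : I → ℝ≥0∞) (ϑ : ℝ≥0∞ → I),
    Continuous θ ∧ StrictAnti θ ∧ Continuous ϑ ∧ Antitone ϑ ∧
    (∀ x y : I, O x y = ϑ (θ x + θ y)) ∧ IsOverlap O ∧
    ((∀ x : I, θ x = a / 2 ↔ x = 1) ∨ (∀ x : ℝ≥0∞, ϑ x = 1 ↔ x ≤ a))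

/-- Condition (2): `O` is obtained by an `(F, T)`-distortion for a pseudo automorphism `F`
and a strict t-norm `T`. -/
def Cond2 (O : I → I → I) : Prop :=
  ∃ (F : I → I) (T : I → I → I), IsPseudoAutomorphism F ∧ IsStrictTNorm T ∧
    ∀ x y : I, O x y = F (T x y)

/-- Condition (3): `O x y = H (φ x * φ y)` for a strictly increasing bijection `φ`
and a pseudo automorphism `H`. -/
def Cond3 (O : I → I → I) : Prop :=
  ∃ (φ : I → I) (H : I → I), StrictMono φ ∧ Function.Bijective φ ∧
    IsPseudoAutomorphism H ∧ ∀ x y : I, O x y = H (φ x * φ y)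

open Filter Topology

/-! ### Additive representation of archimedean ordered monoids -/

section OrderedMonoid

variable {M : Type*} [AddCommMonoid M] [LinearOrder M] [IsOrderedCancelAddMonoid M]
  [CanonicallyOrderedAdd M] [Archimedean M]

/-- Division with remainder by a positive element of an archimedean monoid. -/
lemma exists_nsmul_le_lt_succ_nsmul {e : M} (he : 0 < e) (x : M) :
    ∃ k : ℕ, k • e ≤ x ∧ x < (k + 1) • e := by
  classical
  have hex : ∃ k : ℕ, x < (k + 1) • e := by
    obtain ⟨n, hn⟩ := Archimedean.arch x he
    exact ⟨n, hn.trans_lt (by rw [succ_nsmul]; exact lt_add_of_pos_right _ he)⟩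
  refine ⟨Nat.find hex, ?_, Nat.find_spec hex⟩
  rcases hk : Nat.find hex with _ | k
  · simp
  · exact not_lt.1 (Nat.find_min hex (m := k) (by omega))

/-- A canonically ordered cancellative archimedean monoid embeds into the reals. -/
theorem exists_strictMono_addMonoidHom_real [Nontrivial M] : ∃ f : M →+ ℝ, StrictMono f := by
  obtain ⟨e, he0⟩ := exists_ne (0 : M)
  have he : 0 < e := pos_iff_ne_zero.2 he0
  choose N hN₁ hN₂ using exists_nsmul_le_lt_succ_nsmul he
  have le_of (k l : ℕ) (h : k • e < (l + 1) • e) : k ≤ l :=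
    Nat.lt_succ_iff.1 ((nsmul_left_strictMono he).lt_iff_lt.1 h)
  have hadd₁ (x y : M) : N x + N y ≤ N (x + y) := by
    refine le_of _ _ (lt_of_le_of_lt ?_ (hN₂ (x + y)))
    rw [add_nsmul]
    exact add_le_add (hN₁ x) (hN₁ y)
  have hadd₂ (x y : M) : N (x + y) ≤ N x + N y + 1 := by
    refine le_of _ _ ((hN₁ (x + y)).trans_lt ?_)
    rw [show N x + N y + 1 + 1 = (N x + 1) + (N y + 1) by ring, add_nsmul]
    exact add_lt_add (hN₂ x) (hN₂ y)
  have hbound (n : ℕ) (x : M) : N (n • x) ≤ n * (N x + 1) := by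
    refine le_of _ _ (lt_of_le_of_lt (hN₁ _) (lt_of_le_of_lt (b := (n * (N x + 1)) • e) ?_ ?_))
    · rw [mul_nsmul']
      exact nsmul_le_nsmul_right (hN₂ x).le n
    · exact nsmul_left_strictMono he (Nat.lt_succ_self _)
  have hlim (x : M) : ∃ l : ℝ, Tendsto (fun n : ℕ => (N (n • x) : ℝ) / n) atTop (𝓝 l) := by
    have hsub : Subadditive fun n : ℕ => -(N (n • x) : ℝ) := by
      intro m n
      have := hadd₁ (m • x) (n • x)
      rw [← add_nsmul] at this
      have h' : (N (m • x) : ℝ) + N (n • x) ≤ N ((m + n) • x) := by exact_mod_cast this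
      linarith
    have hbdd : BddBelow (Set.range fun n : ℕ => -(N (n • x) : ℝ) / n) := by
      refine ⟨-((N x : ℝ) + 1), ?_⟩
      rintro _ ⟨n, rfl⟩
      have h' : (N (n • x) : ℝ) ≤ n * (N x + 1) := by exact_mod_cast hbound n x
      dsimp only
      rw [neg_div, neg_le_neg_iff]
      exact div_le_of_le_mul₀ n.cast_nonneg (by positivity) (by linarith)
    refine ⟨-hsub.lim, ((hsub.tendsto_lim hbdd).neg).congr fun n => ?_⟩
    rw [neg_div, neg_neg]
  choose f hf using hlim
  have hfadd (x y : M) : f (x + y) = f x + f y := by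
    have hsum := (hf x).add (hf y)
    have hup := hsum.add tendsto_one_div_atTop_nhds_zero_nat
    rw [add_zero] at hup
    refine tendsto_nhds_unique (hf (x + y))
      (tendsto_of_tendsto_of_tendsto_of_le_of_le hsum hup (fun n => ?_) fun n => ?_)
    · dsimp only
      rw [← add_div, nsmul_add]
      have : (N (n • x) : ℝ) + N (n • y) ≤ N (n • x + n • y) := by exact_mod_cast hadd₁ _ _
      gcongr
    · dsimp only
      rw [← add_div, ← add_div, nsmul_add]
      have : (N (n • x + n • y) : ℝ) ≤ N (n • x) + N (n • y) + 1 := by exact_mod_cast hadd₂ _ _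
      gcongr
  have hfpos (z : M) (hz : 0 < z) : 0 < f z := by
    obtain ⟨k, hk⟩ := Archimedean.arch e hz
    let g : M →+ ℝ := AddMonoidHom.mk' f hfadd
    have hge : 1 ≤ f (k • z) := by
      refine ge_of_tendsto (hf (k • z)) (eventually_atTop.2 ⟨1, fun n hn => ?_⟩)
      have : n ≤ N (n • k • z) :=
        le_of _ _ (lt_of_le_of_lt (nsmul_le_nsmul_right hk n) (hN₂ _))
      rw [le_div_iff₀ (by positivity), one_mul]
      exact_mod_cast this
    have hk' : f (k • z) = k * f z := (map_nsmul g k z).trans (nsmul_eq_mul _ _)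
    rw [hk'] at hge
    by_contra! h
    have := mul_nonpos_of_nonneg_of_nonpos (k.cast_nonneg (α := ℝ)) h
    linarith
  refine ⟨AddMonoidHom.mk' f hfadd, fun x y hxy => ?_⟩
  obtain ⟨z, rfl⟩ := exists_add_of_le hxy.le
  have hz : 0 < z := pos_of_lt_add_right hxy
  simpa [hfadd] using hfpos z hz

end OrderedMonoid

/-- A strictly monotone additive map on a monoid with halves takes values densely in `[0, ∞)`. -/
theorem exists_map_between_of_halves {M : Type*} [AddCommMonoid M] [LinearOrder M]
    [CanonicallyOrderedAdd M] [Nontrivial M] (hhalf : ∀ x : M, ∃ y, y + y = x)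
    (f : M →+ ℝ) (hf : StrictMono f) {s t : ℝ} (hs : 0 ≤ s) (hst : s < t) :
    ∃ x, s < f x ∧ f x < t := by
  obtain ⟨e, he⟩ := exists_ne (0 : M)
  have hfe : 0 < f e := by simpa using hf (pos_iff_ne_zero.2 he)
  have hpow (n : ℕ) : ∃ x : M, f x = (1 / 2) ^ n * f e := by
    induction n with
    | zero => exact ⟨e, by simp⟩
    | succ n ih =>
      obtain ⟨x, hx⟩ := ih
      obtain ⟨y, rfl⟩ := hhalf x
      refine ⟨y, ?_⟩
      rw [map_add] at hx
      rw [pow_succ]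
      linarith
  obtain ⟨n, hn⟩ := exists_pow_lt_of_lt_one (div_pos (sub_pos.2 hst) hfe)
    (show (1 / 2 : ℝ) < 1 by norm_num)
  rw [lt_div_iff₀ hfe] at hn
  obtain ⟨x, hx⟩ := hpow n
  have hxpos : 0 < f x := by rw [hx]; positivity
  rw [← hx] at hn
  have hle := (le_div_iff₀ hxpos).1 (Nat.floor_le (div_nonneg hs hxpos.le))
  have hlt := (div_lt_iff₀ hxpos).1 (Nat.lt_floor_add_one (s / f x))
  refine ⟨(⌊s / f x⌋₊ + 1) • x, ?_, ?_⟩ <;> rw [map_nsmul, nsmul_eq_mul] <;> push_cast <;>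
    linarith

/-! ### The exponential scale on `[0, ∞]` -/

/-- The decreasing bijection `u ↦ exp (-u)` from `[0, ∞]` onto the unit interval. -/
noncomputable def expNeg (u : ℝ≥0∞) : I :=
  ⟨if u = ⊤ then 0 else Real.exp (-u.toReal), by
    split_ifs
    · simp
    · exact ⟨(Real.exp_pos _).le, Real.exp_le_one_iff.2 (by simp)⟩⟩

lemma expNeg_top : expNeg ⊤ = 0 := by
  ext; simp [expNeg]

lemma expNeg_zero : expNeg 0 = 1 := by
  ext; simp [expNeg]

lemma coe_expNeg {u : ℝ≥0∞} (hu : u ≠ ⊤) : (expNeg u : ℝ) = Real.exp (-u.toReal) := by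
  simp [expNeg, hu]

lemma expNeg_add (u v : ℝ≥0∞) : expNeg (u + v) = expNeg u * expNeg v := by
  rcases eq_or_ne u ⊤ with rfl | hu
  · simp [expNeg_top]
  rcases eq_or_ne v ⊤ with rfl | hv
  · simp [expNeg_top]
  ext
  rw [Set.Icc.coe_mul, coe_expNeg hu, coe_expNeg hv, coe_expNeg (ENNReal.add_ne_top.2 ⟨hu, hv⟩),
    ENNReal.toReal_add hu hv, neg_add, Real.exp_add]

lemma expNeg_strictAnti : StrictAnti expNeg := by
  intro u v huv
  have hu : u ≠ ⊤ := huv.ne_top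
  rw [← Subtype.coe_lt_coe, coe_expNeg hu]
  rcases eq_or_ne v ⊤ with rfl | hv
  · simpa [expNeg_top] using Real.exp_pos _
  · rw [coe_expNeg hv, Real.exp_lt_exp, neg_lt_neg_iff]
    exact (ENNReal.toReal_lt_toReal hu hv).2 huv

lemma expNeg_surjective : Function.Surjective expNeg := by
  intro t
  rcases eq_or_lt_of_le (unitInterval.nonneg t) with ht | ht
  · exact ⟨⊤, by ext; simp [expNeg_top, ← ht]⟩
  · refine ⟨ENNReal.ofReal (-Real.log t), ?_⟩
    ext
    rw [coe_expNeg ENNReal.ofReal_ne_top, ENNReal.toReal_ofReal, neg_neg, Real.exp_log ht]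
    exact neg_nonneg.2 (Real.log_nonpos ht.le (unitInterval.le_one t))

/-- `expNeg` as an order isomorphism onto the order dual. -/
noncomputable def expNegIso : ℝ≥0∞ ≃o Iᵒᵈ :=
  StrictMono.orderIsoOfSurjective (OrderDual.toDual ∘ expNeg) expNeg_strictAnti.dual_right
    expNeg_surjective

lemma continuous_expNeg : Continuous expNeg :=
  continuous_ofDual.comp expNegIso.continuous

/-- The inverse of `expNeg`. -/
noncomputable def negLog (t : I) : ℝ≥0∞ := expNegIso.symm (OrderDual.toDual t)

lemma expNeg_negLog (t : I) : expNeg (negLog t) = t :=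
  expNegIso.apply_symm_apply (OrderDual.toDual t)

lemma continuous_negLog : Continuous negLog :=
  expNegIso.symm.continuous.comp continuous_toDual

lemma negLog_strictAnti : StrictAnti negLog := fun _ _ h =>
  expNegIso.symm.strictMono (OrderDual.toDual_lt_toDual.2 h)

lemma negLog_eq_zero_iff {t : I} : negLog t = 0 ↔ t = 1 := by
  rw [← expNeg_strictAnti.injective.eq_iff, expNeg_negLog, expNeg_zero]

/-! ### Order automorphisms of the unit interval and the three conditions -/

/-- A continuous self-map of the unit interval fixing `0` and `1` is onto. -/
lemma surjective_of_continuous_of_fix {φ : I → I} (hc : Continuous φ) (h0 : φ 0 = 0)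
    (h1 : φ 1 = 1) : Function.Surjective φ := by
  intro t
  exact mem_range_of_exists_le_of_exists_ge hc ⟨0, h0.le.trans t.2.1⟩
    ⟨1, le_of_le_of_eq t.2.2 h1.symm⟩

lemma unitInterval.orderIso_zero (e : I ≃o I) : e 0 = 0 := e.map_bot

lemma unitInterval.orderIso_one (e : I ≃o I) : e 1 = 1 := e.map_top

theorem cond3_iff_orderIso {O : I → I → I} : Cond3 O ↔ ∃ (e : I ≃o I) (H : I → I),
    IsPseudoAutomorphism H ∧ ∀ x y : I, O x y = H (e x * e y) := by
  constructor
  · rintro ⟨φ, H, hφ, hb, hH, h⟩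
    exact ⟨hφ.orderIsoOfSurjective φ hb.2, H, hH, h⟩
  · rintro ⟨e, H, hH, h⟩
    exact ⟨e, H, e.strictMono, e.bijective, hH, h⟩

theorem Cond3.isOverlap {O : I → I → I} (h : Cond3 O) : IsOverlap O := by
  obtain ⟨e, H, ⟨hm, hc, h1, h0⟩, h⟩ := cond3_iff_orderIso.1 h
  have he0 (x : I) : e x = 0 ↔ x = 0 := map_eq_bot_iff e
  have he1 (x : I) : e x = 1 ↔ x = 1 := map_eq_top_iff e
  have hone (x y : I) : x * y = 1 ↔ x = 1 ∧ y = 1 := by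
    refine ⟨fun hxy => ⟨?_, ?_⟩, fun hxy => by simp [hxy]⟩
    · exact le_antisymm (unitInterval.le_one x) (hxy ▸ unitInterval.mul_le_left)
    · exact le_antisymm (unitInterval.le_one y) (hxy ▸ unitInterval.mul_le_right)
  refine ⟨fun x y => ?_, fun x y => ?_, fun x y => ?_, fun y a b hab => ?_, fun x a b hab => ?_, ?_⟩
  · rw [h, h, mul_comm]
  · rw [h, h0, mul_eq_zero, mul_eq_zero, he0, he0]
  · rw [h, h1, hone, hone, he1, he1]
  · simp only [h]
    exact hm (mul_le_mul_left (e.monotone hab) _)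
  · simp only [h]
    exact hm (mul_le_mul_right (e.monotone hab) _)
  · simp only [h]
    have := e.continuous
    fun_prop

theorem Cond3.cond1 {O : I → I → I} (hO : Cond3 O) : Cond1 O := by
  obtain ⟨e, H, hH, h⟩ := cond3_iff_orderIso.1 hO
  refine ⟨0, by simp, negLog ∘ e, H ∘ expNeg, continuous_negLog.comp e.continuous,
    negLog_strictAnti.comp_strictMono e.strictMono, hH.2.1.comp continuous_expNeg,
    hH.1.comp_antitone expNeg_strictAnti.antitone, fun x y => ?_, hO.isOverlap, Or.inl fun x => ?_⟩
  · simp [h, expNeg_add, expNeg_negLog]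
  · simp only [Function.comp_apply, ENNReal.zero_div, negLog_eq_zero_iff]
    exact map_eq_top_iff e

theorem Cond1.cond3 {O : I → I → I} (hO : Cond1 O) : Cond3 O := by
  obtain ⟨-, -, θ, ϑ, hθc, hθ, -, hϑ, h, ⟨-, h0, h1, hm, -, hc⟩, -⟩ := hO
  have hfin : θ 1 ≠ ⊤ := (hθ (show (0 : I) < 1 from zero_lt_one)).ne_top
  have htop : θ 0 = ⊤ := by
    by_contra hne
    have hlt : θ 1 < θ 0 := hθ zero_lt_one
    obtain ⟨x, hx⟩ : (θ 1 + θ 0) / 2 ∈ Set.range θ := by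
      refine mem_range_of_exists_le_of_exists_ge hθc ⟨1, ?_⟩ ⟨0, ?_⟩
      · rw [ENNReal.le_div_iff_mul_le (by simp) (by simp), mul_two]
        gcongr
      · refine ENNReal.div_le_of_le_mul ?_
        rw [mul_two]
        gcongr
    have hxx : O x x = O 1 0 := by rw [h, h, hx, ENNReal.add_halves]
    have hx0 : x = 0 := by
      have := (h0 x x).1 (hxx.trans ((h0 1 0).2 (mul_zero 1)))
      simpa using this
    have : θ 0 + θ 0 = θ 1 + θ 0 := by
      rw [hx0] at hx
      nth_rewrite 1 2 [hx]
      exact ENNReal.add_halves _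
    exact hlt.ne' ((ENNReal.add_left_inj hne).1 this)
  have hle (x : I) : θ 1 ≤ θ x := hθ.antitone (unitInterval.le_one x)
  let φ : I → I := fun x => expNeg (θ x - θ 1)
  have hφ : StrictMono φ := fun x y hxy =>
    expNeg_strictAnti (((ENNReal.cancel_of_ne hfin).tsub_lt_tsub_iff_right (hle y)).2 (hθ hxy))
  have hφc : Continuous φ := continuous_expNeg.comp ((ENNReal.continuous_sub_right _).comp hθc)
  have hφ0 : φ 0 = 0 := by simp [φ, htop, hfin, expNeg_top]
  have hφ1 : φ 1 = 1 := by simp [φ, expNeg_zero]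
  let e : I ≃o I := hφ.orderIsoOfSurjective φ (surjective_of_continuous_of_fix hφc hφ0 hφ1)
  refine cond3_iff_orderIso.2 ⟨e, fun t => O (e.symm t) 1, ⟨(hm 1).comp e.symm.monotone,
    hc.comp (e.symm.continuous.prodMk continuous_const), fun t => ?_, fun t => ?_⟩, fun x y => ?_⟩
  · rw [h1, mul_one]
    exact map_eq_top_iff e.symm
  · rw [h0, mul_one]
    exact map_eq_bot_iff e.symm
  · set z := e.symm (e x * e y) with hz
    have hez : φ z = φ x * φ y := e.apply_symm_apply _
    rw [← expNeg_add, expNeg_strictAnti.injective.eq_iff] at hez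
    change O x y = O z 1
    rw [h, h]
    congr 1
    rw [← tsub_add_cancel_of_le (hle z), hez, add_assoc, add_assoc,
      ← add_assoc (θ y - θ 1), tsub_add_cancel_of_le (hle y), ← add_assoc, add_right_comm,
      tsub_add_cancel_of_le (hle x)]

theorem Cond3.cond2 {O : I → I → I} (hO : Cond3 O) : Cond2 O := by
  obtain ⟨e, H, ⟨hm, hc, h1, h0⟩, h⟩ := cond3_iff_orderIso.1 hO
  have hec := e.continuous
  have hec' := e.symm.continuous
  have he1 : e 1 = 1 := unitInterval.orderIso_one e
  have hpos {x : I} (hx : 0 < x) : 0 < e x := by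
    simpa [unitInterval.orderIso_zero] using e.strictMono hx
  refine ⟨H ∘ e, fun x y => e.symm (e x * e y), ⟨hm.comp e.monotone, hc.comp hec, fun x => ?_,
    fun x => ?_⟩, ⟨⟨fun x y => ?_, fun x y z => ?_, fun y a b hab => ?_, fun x a b hab => ?_,
    fun x => ?_⟩, ?_, fun y hy a _ b _ hab => ?_, fun x hx a _ b _ hab => ?_⟩, fun x y => ?_⟩
  · exact (h1 _).trans (map_eq_top_iff e)
  · exact (h0 _).trans (map_eq_bot_iff e)
  · simp only [mul_comm]
  · simp [mul_assoc]
  · exact e.symm.monotone (mul_le_mul_left (e.monotone hab) _)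
  · exact e.symm.monotone (mul_le_mul_right (e.monotone hab) _)
  · simp [he1]
  · fun_prop
  · exact e.symm.strictMono (mul_lt_mul_of_pos_right (e.strictMono hab) (hpos hy))
  · exact e.symm.strictMono (mul_lt_mul_of_pos_left (e.strictMono hab) (hpos hx))
  · simp [h]

/-! ### Strict t-norms -/

namespace IsStrictTNorm

variable {T : I → I → I} (hT : IsStrictTNorm T)

include hT

lemma one_right (x : I) : T x 1 = x := hT.1.2.2.2.2 x

lemma comm (x y : I) : T x y = T y x := hT.1.1 x y

lemma one_left (x : I) : T 1 x = x := (hT.comm 1 x).trans (hT.one_right x)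

lemma zero_right (x : I) : T x 0 = 0 :=
  le_antisymm ((hT.1.2.2.1 0 (unitInterval.le_one x)).trans_eq (hT.one_left 0))
    unitInterval.nonneg'

lemma zero_left (x : I) : T 0 x = 0 := (hT.comm 0 x).trans (hT.zero_right x)

lemma pos {x y : I} (hx : 0 < x) (hy : 0 < y) : 0 < T x y := by
  obtain ⟨z, hz, hzx⟩ := exists_between hx
  exact unitInterval.nonneg'.trans_lt (hT.2.2.1 y hy hz hx hzx)

lemma continuous_right (x : I) : Continuous (T x) :=
  hT.2.1.comp (continuous_const.prodMk continuous_id)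

lemma le_iff {x y z : I} (hx : 0 < x) (hy : 0 < y) (hz : 0 < z) : T x y ≤ T x z ↔ y ≤ z :=
  (hT.2.2.2 x hx).le_iff_le hy hz

lemma exists_eq_of_le {x y : I} (hx : 0 < x) (hxy : x ≤ y) : ∃ z, 0 < z ∧ T y z = x := by
  obtain ⟨z, hz⟩ : x ∈ Set.range (T y) :=
    mem_range_of_exists_le_of_exists_ge (hT.continuous_right y)
      ⟨0, (hT.zero_right y).trans_le unitInterval.nonneg'⟩ ⟨1, by rwa [hT.one_right]⟩
  refine ⟨z, unitInterval.pos_iff_ne_zero.2 ?_, hz⟩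
  rintro rfl
  rw [hT.zero_right] at hz
  exact hx.ne hz

lemma exists_sqrt (x : I) : ∃ z, T z z = x :=
  mem_range_of_exists_le_of_exists_ge (hT.2.1.comp (continuous_id.prodMk continuous_id))
    ⟨0, (hT.zero_right 0).trans_le unitInterval.nonneg'⟩
    ⟨1, unitInterval.le_one'.trans_eq (hT.one_right 1).symm⟩

/-- Powers with respect to a strict t-norm tend to zero. -/
lemma exists_iterate_le {x y : I} (hx : 0 < x) (hy : y < 1) : ∃ n : ℕ, (T y)^[n] 1 ≤ x := by
  by_contra! hlt
  have hanti : Antitone fun n : ℕ => (T y)^[n] 1 := antitone_nat_of_succ_le fun n => by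
    rw [Function.iterate_succ_apply']
    exact (hT.1.2.2.1 _ (unitInterval.le_one y)).trans_eq (hT.one_left _)
  have hlim := tendsto_atTop_iInf hanti
  set L := ⨅ n : ℕ, (T y)^[n] 1
  have hL : 0 < L := hx.trans_le (le_iInf fun n => (hlt n).le)
  have hfix : T y L = L := by
    refine tendsto_nhds_unique (((hT.continuous_right y).tendsto L).comp hlim) ?_
    refine (hlim.comp (tendsto_add_atTop_nat 1)).congr fun n => ?_
    simp [Function.iterate_succ_apply']
  rcases eq_or_lt_of_le (unitInterval.nonneg' (t := y)) with rfl | hy0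
  · rw [hT.zero_left] at hfix
    exact hL.ne hfix
  · have := hT.2.2.1 L hL hy0 (zero_lt_one (α := I)) hy
    simp only [hT.one_left, hfix, lt_irrefl] at this

end IsStrictTNorm

/-- The interval `(0, 1]` with the reversed order and the operation `T` written additively. -/
structure TNormCarrier (T : I → I → I) where
  /-- The underlying point. -/
  val : I
  pos : 0 < val

namespace TNormCarrier

variable {T : I → I → I}

@[ext]
lemma ext {x y : TNormCarrier T} (h : x.val = y.val) : x = y := by
  cases x; cases y; simpa using h

noncomputable instance : LinearOrder (TNormCarrier T) :=
  LinearOrder.lift' (fun x => OrderDual.toDual x.val) fun _ _ h => ext h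

lemma le_def {x y : TNormCarrier T} : x ≤ y ↔ y.val ≤ x.val := Iff.rfl

lemma lt_def {x y : TNormCarrier T} : x < y ↔ y.val < x.val := Iff.rfl

variable [hT : Fact (IsStrictTNorm T)]

instance : Add (TNormCarrier T) := ⟨fun x y => ⟨T x.val y.val, hT.out.pos x.pos y.pos⟩⟩

instance : Zero (TNormCarrier T) := ⟨⟨1, zero_lt_one⟩⟩

lemma val_add (x y : TNormCarrier T) : (x + y).val = T x.val y.val := rfl

instance : AddCommMonoid (TNormCarrier T) where
  add_assoc x y z := ext (hT.out.1.2.1 _ _ _)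
  zero_add x := ext (hT.out.one_left _)
  add_zero x := ext (hT.out.one_right _)
  add_comm x y := ext (hT.out.comm _ _)
  nsmul := nsmulRec

lemma val_nsmul (n : ℕ) (x : TNormCarrier T) : (n • x).val = (T x.val)^[n] 1 := by
  induction n with
  | zero => rw [zero_nsmul]; rfl
  | succ n ih => rw [succ_nsmul', val_add, ih, Function.iterate_succ_apply']

instance : IsOrderedCancelAddMonoid (TNormCarrier T) where
  add_le_add_left x y h z := by
    rw [add_comm x, add_comm y]
    exact (hT.out.le_iff z.pos y.pos x.pos).2 h
  le_of_add_le_add_left z x y h := (hT.out.le_iff z.pos y.pos x.pos).1 h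

instance : CanonicallyOrderedAdd (TNormCarrier T) where
  exists_add_of_le {x y} h := by
    obtain ⟨z, hz, hxy⟩ := hT.out.exists_eq_of_le y.pos h
    exact ⟨⟨z, hz⟩, ext hxy.symm⟩
  le_self_add x y :=
    (hT.out.1.2.2.2.1 _ (unitInterval.le_one y.val)).trans_eq (hT.out.one_right _)
  le_add_self x y :=
    (hT.out.1.2.2.1 _ (unitInterval.le_one y.val)).trans_eq (hT.out.one_left _)

instance : Archimedean (TNormCarrier T) where
  arch x y hy := by
    obtain ⟨n, hn⟩ := hT.out.exists_iterate_le x.pos (lt_def.1 hy)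
    exact ⟨n, le_def.2 ((val_nsmul n y).trans_le hn)⟩

instance : Nontrivial (TNormCarrier T) := by
  obtain ⟨z, hz, hz1⟩ := exists_between (zero_lt_one (α := I))
  exact ⟨⟨⟨z, hz⟩, 0, fun h => hz1.ne (congrArg val h)⟩⟩

lemma exists_half (x : TNormCarrier T) : ∃ y, y + y = x := by
  obtain ⟨z, hz⟩ := hT.out.exists_sqrt x.val
  refine ⟨⟨z, unitInterval.pos_iff_ne_zero.2 ?_⟩, ext hz⟩
  rintro rfl
  rw [hT.out.zero_right] at hz
  exact x.pos.ne hz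

end TNormCarrier

/-- Every strict t-norm is isomorphic to the product. -/
theorem IsStrictTNorm.exists_orderIso_mul {T : I → I → I} (hT : IsStrictTNorm T) :
    ∃ e : I ≃o I, ∀ x y, e (T x y) = e x * e y := by
  have : Fact (IsStrictTNorm T) := ⟨hT⟩
  obtain ⟨f, hf⟩ := exists_strictMono_addMonoidHom_real (M := TNormCarrier T)
  have hf0 (x : TNormCarrier T) : 0 ≤ f x := by simpa using hf.monotone (_root_.zero_le : 0 ≤ x)
  let φ : I → I := fun x => if hx : 0 < x then expNeg (ENNReal.ofReal (f ⟨x, hx⟩)) else 0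
  have hφ0 : φ 0 = 0 := by simp [φ]
  have hφpos {x : I} (hx : 0 < x) : φ x = expNeg (ENNReal.ofReal (f ⟨x, hx⟩)) := dif_pos hx
  have hφ1 : φ 1 = 1 := by
    have : f ⟨1, zero_lt_one⟩ = 0 := map_zero f
    rw [hφpos zero_lt_one, this, ENNReal.ofReal_zero, expNeg_zero]
  have hmul (x y : I) : φ (T x y) = φ x * φ y := by
    rcases eq_or_lt_of_le (unitInterval.nonneg' (t := x)) with rfl | hx
    · simp [hT.zero_left, hφ0]
    rcases eq_or_lt_of_le (unitInterval.nonneg' (t := y)) with rfl | hy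
    · simp [hT.zero_right, hφ0]
    rw [hφpos hx, hφpos hy, hφpos (hT.pos hx hy), ← expNeg_add,
      ← ENNReal.ofReal_add (hf0 _) (hf0 _), ← map_add]
    rfl
  have hφ : StrictMono φ := by
    intro x y hxy
    have hy : 0 < y := unitInterval.nonneg'.trans_lt hxy
    rw [hφpos hy]
    rcases eq_or_lt_of_le (unitInterval.nonneg' (t := x)) with rfl | hx
    · rw [hφ0, ← expNeg_top]
      exact expNeg_strictAnti ENNReal.ofReal_lt_top
    · rw [hφpos hx]
      have hlt : f ⟨y, hy⟩ < f ⟨x, hx⟩ := hf (TNormCarrier.lt_def.2 hxy)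
      exact expNeg_strictAnti ((ENNReal.ofReal_lt_ofReal_iff_of_nonneg (hf0 _)).2 hlt)
  have hdense : DenseRange φ := by
    refine dense_of_exists_between fun a b hab => ?_
    obtain ⟨s, rfl⟩ := expNeg_surjective a
    obtain ⟨t, rfl⟩ := expNeg_surjective b
    have hts : t < s := expNeg_strictAnti.lt_iff_gt.1 hab
    obtain ⟨r, htr, hrs⟩ := ENNReal.lt_iff_exists_real_btwn.1 hts |>.imp fun _ h => h.2
    have ht := hts.ne_top
    have htr' : t.toReal < r := (ENNReal.lt_ofReal_iff_toReal_lt ht).1 htr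
    obtain ⟨x, hx₁, hx₂⟩ := exists_map_between_of_halves TNormCarrier.exists_half f hf
      ENNReal.toReal_nonneg htr'
    refine ⟨_, ⟨x.val, hφpos x.pos⟩, expNeg_strictAnti ?_, expNeg_strictAnti ?_⟩
    · exact (ENNReal.ofReal_le_ofReal hx₂.le).trans_lt hrs
    · exact (ENNReal.lt_ofReal_iff_toReal_lt ht).2 hx₁
  exact ⟨hφ.orderIsoOfSurjective φ (surjective_of_continuous_of_fix
    (hφ.monotone.continuous_of_denseRange hdense) hφ0 hφ1), hmul⟩

theorem Cond2.cond3 {O : I → I → I} (hO : Cond2 O) : Cond3 O := by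
  obtain ⟨F, T, ⟨hm, hc, h1, h0⟩, hT, h⟩ := hO
  obtain ⟨e, he⟩ := hT.exists_orderIso_mul
  refine cond3_iff_orderIso.2 ⟨e, F ∘ e.symm, ⟨hm.comp e.symm.monotone, hc.comp e.symm.continuous,
    fun x => ?_, fun x => ?_⟩, fun x y => ?_⟩
  · exact (h1 _).trans (map_eq_top_iff e.symm)
  · exact (h0 _).trans (map_eq_bot_iff e.symm)
  · simp [h, ← he]

theorem stmt9 (O : I → I → I) : (Cond1 O ↔ Cond2 O) ∧ (Cond2 O ↔ Cond3 O) := by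
  exact ⟨⟨fun h => h.cond3.cond2, fun h => h.cond3.cond1⟩, fun h => h.cond3, fun h => h.cond2⟩
end

section
/- Fix a∈[0,∞). Let t:[0,1]→[0,∞] and s:[0,∞]→[0,1] be continuous and increasing functions such that: (i) for every x∈[0,1], t(x)=a/2 if and only if x=0; and (ii) the function G_{t,s}:[0,1]²→[0,1] defined by G_{t,s}(x,y)=s(t(x)+t(y)) is a grouping function. Then for every x∈[0,∞], x∈[0,a] if and only if s(x)=0. -/
open unitInterval ENNReal

theorem stmt14 (a : ℝ≥0∞) (ha : a ≠ ⊤)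
    (t : I → ℝ≥0∞) (s : ℝ≥0∞ → I)
    (htc : Continuous t) (hti : Monotone t)
    (hsc : Continuous s) (hsi : Monotone s)
    (h1 : ∀ x : I, t x = a / 2 ↔ x = 0)
    (hG : IsGrouping fun x y => s (t x + t y)) :
    ∀ x : ℝ≥0∞, x ≤ a ↔ s x = 0 := by
  have h0 : t 0 = a / 2 := (h1 0).2 rfl
  have hsa : s a = 0 := by
    have h : s (t 0 + t 0) = 0 := (hG.2.1 0 0).2 ⟨rfl, rfl⟩
    rwa [h0, ENNReal.add_halves] at h
  intro x
  constructor
  · intro hx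
    exact le_antisymm (hsa ▸ hsi hx) unitInterval.nonneg'
  · intro hx
    by_contra! hax
    have hcont : Continuous fun y : I => t y + t y := htc.add htc
    have hnhds : ∀ᶠ y in nhds (0 : I), t y + t y < x :=
      hcont.continuousAt.eventually_lt continuousAt_const (by simpa [h0] using hax)
    have hpunct : ∀ᶠ y in nhdsWithin (0 : I) {0}ᶜ, t y + t y < x ∧ y ∈ ({0}ᶜ : Set I) :=
      (hnhds.filter_mono nhdsWithin_le_nhds).and self_mem_nhdsWithin
    obtain ⟨y, hyx, hy⟩ := hpunct.exists
    have hsy : s (t y + t y) = 0 := le_antisymm (hx ▸ hsi hyx.le) unitInterval.nonneg'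
    exact hy ((hG.2.1 y y).1 hsy).1
end
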